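/- arXiv:2411.16598 — 2 statements merged into one kernel-verified Lean document; each statement's English description precedes it below -/
import Mathlib

section
/- Correctness of checkpointed backpropagation: let E be a complete real inner product space, n a natural number, g : Fin n → (E → E) a family of step maps, and x : Fin (n+1) → E a trajectory with x₀ arbitrary and x_{k+1} = g_k(x_k) for each k < n. Assume each g_k is differentiable at x_k and F : E → ℝ is differentiable at x_n. Define vectors c_k by downward recursion: c_n = ∇F(x_n) and, for k < n, c_k = gradient at x_k of the map v ↦ ⟪g_k v, c_{k+1}⟫ (with c_{k+1} held fixed). Then c_0 equals the gradient at x_0 of the full composition x ↦ F(g_{n−1}(⋯ g_1(g_0(x))⋯)). -/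
open scoped RealInnerProductSpace

/-- Correctness of checkpointed backpropagation (Algorithm 2 / DiffGrad):
with trajectory `x (k+1) = g k (x k)` for `k < n`, each `g k` differentiable at `x k`,
`F` differentiable at `x n`, and backward vectors `c` defined by downward recursion
`c n = ∇F(x n)` and `c k = ∇_{x k} ⟪g k ·, c (k+1)⟫`, the vector `c 0` equals the
gradient at `x 0` of the full composition `v ↦ F (g (n-1) (⋯ (g 0 v) ⋯))`. -/
theorem stmt1 {E : Type*} [NormedAddCommGroup E] [InnerProductSpace ℝ E] [CompleteSpace E]
    (n : ℕ) (g : ℕ → E → E) (x : ℕ → E) (F : E → ℝ)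
    (hx : ∀ k < n, x (k + 1) = g k (x k))
    (hg : ∀ k < n, DifferentiableAt ℝ (g k) (x k))
    (hF : DifferentiableAt ℝ F (x n))
    (c : ℕ → E)
    (hcn : c n = gradient F (x n))
    (hc : ∀ k < n, c k = gradient (fun v => ⟪g k v, c (k + 1)⟫) (x k)) :
    c 0 = gradient (fun v => F (Nat.rec (motive := fun _ => E) v (fun k acc => g k acc) n))
      (x 0) := by
  induction n generalizing F with
  | zero => exact hcn
  | succ n ih =>
    have hgn := hg n (Nat.lt_succ_self n)
    have hxn := hx n (Nat.lt_succ_self n)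
    rw [hxn] at hF hcn
    refine ih (fun v => F (g n v)) (fun k hk => hx k (by omega)) (fun k hk => hg k (by omega))
      (hF.comp (x n) hgn) ?_ (fun k hk => hc k (by omega))
    rw [hc n (Nat.lt_succ_self n)]
    unfold gradient
    congr 1
    ext w
    have h1 : fderiv ℝ (fun v => F (g n v)) (x n)
        = (fderiv ℝ F (g n (x n))).comp (fderiv ℝ (g n) (x n)) :=
      fderiv_comp (x n) hF hgn
    rw [h1, fderiv_inner_apply ℝ hgn (differentiableAt_const _), hcn]
    simp [gradient, real_inner_comm]
    rw [real_inner_comm, InnerProductSpace.toDual_symm_apply]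
end

section
/- Guidance gradient superposition over a multi-step chain (eq. (10)): let E be a complete real inner product space, n a natural number, s : Fin n → (E → E → E) a family of guided step maps, x₀ ∈ E a starting state, and g ∈ E a guidance input. For g' ∈ E define the full chain X(g') by X₀(g') = x₀ and X_{k+1}(g') = s_k(X_k(g'), g'), and for each j < n define the j-th partial chain Y^j(g') by the same recursion except that the guidance argument is g' at step j and the fixed g at every other step. Assume each s_k is differentiable (as a map on E × E) at (X_k(g), g) and F : E → ℝ is differentiable at X_n(g). Then the gradient at g of g' ↦ F(X_n(g')) equals the sum over j = 0, …, n−1 of the gradients at g of g' ↦ F(Y^j_n(g')). -/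
/-- Guidance gradient superposition over a multi-step chain (eq. (10)): for the guided
chain `X g' 0 = x₀`, `X g' (k+1) = s k (X g' k) g'` and the `j`-th partial chains
`Y j g'` which use the perturbed guidance `g'` only at step `j` (and the fixed `g`
elsewhere), with each `s k` differentiable at `(X g k, g)` as a map on `E × E` and
`F` differentiable at `X g n`, the gradient at `g` of `g' ↦ F (X g' n)` equals the sum
over `j < n` of the gradients at `g` of `g' ↦ F (Y j g' n)`. -/
theorem stmt4 {E : Type*} [NormedAddCommGroup E] [InnerProductSpace ℝ E] [CompleteSpace E]
    (n : ℕ) (s : ℕ → E → E → E) (x₀ : E) (g : E) (F : E → ℝ)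
    (X : E → ℕ → E)
    (hX0 : ∀ g', X g' 0 = x₀)
    (hXs : ∀ g' k, X g' (k + 1) = s k (X g' k) g')
    (Y : ℕ → E → ℕ → E)
    (hY0 : ∀ j g', Y j g' 0 = x₀)
    (hYs : ∀ j g' k, Y j g' (k + 1) = s k (Y j g' k) (if k = j then g' else g))
    (hs : ∀ k < n, DifferentiableAt ℝ (fun p : E × E => s k p.1 p.2) (X g k, g))
    (hF : DifferentiableAt ℝ F (X g n)) :
    gradient (fun g' => F (X g' n)) g =
      ∑ j ∈ Finset.range n, gradient (fun g' => F (Y j g' n)) g := by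
  have hYX : ∀ j k, Y j g k = X g k := by
    intro j k
    induction k with
    | zero => rw [hY0, hX0]
    | succ k ih => rw [hYs, hXs, ih, ite_self]
  have key : ∀ k ≤ n, ∃ D : ℕ → E →L[ℝ] E,
      (∀ j, HasFDerivAt (fun g' => Y j g' k) (D j) g) ∧ (∀ j, k ≤ j → D j = 0) ∧
      HasFDerivAt (fun g' => X g' k) (∑ j ∈ Finset.range k, D j) g := by
    intro k
    induction k with
    | zero =>
      intro _
      refine ⟨fun _ => 0, ?_, fun _ _ => rfl, ?_⟩
      · intro j
        simp only [hY0]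
        exact hasFDerivAt_const _ _
      · simp only [hX0, Finset.range_zero, Finset.sum_empty]
        exact hasFDerivAt_const _ _
    | succ k ih =>
      intro hk
      obtain ⟨D, hD, hD0, hX⟩ := ih (by omega)
      obtain ⟨L, hL⟩ := hs k (by omega)
      refine ⟨fun j => L.comp ((D j).prod (if k = j then ContinuousLinearMap.id ℝ E else 0)),
        ?_, ?_, ?_⟩
      · intro j
        simp only [hYs]
        have h2 : HasFDerivAt (fun g' : E => if k = j then g' else g)
            (if k = j then ContinuousLinearMap.id ℝ E else 0) g := by
          split_ifs
          · exact hasFDerivAt_id g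
          · exact hasFDerivAt_const _ _
        have h3 := (hD j).prodMk h2
        refine HasFDerivAt.comp (g := fun p : E × E => s k p.1 p.2) g ?_ h3
        simp only [hYX, ite_self]
        exact hL
      · intro j hj
        have : k ≠ j := by omega
        ext v
        simp [hD0 j (by omega), this]
        exact map_zero L
      · simp only [hXs]
        have h3 := HasFDerivAt.comp (g := fun p : E × E => s k p.1 p.2) (f := fun g' => (X g' k, id g')) g hL
          (hX.prodMk (hasFDerivAt_id g))
        refine h3.congr_fderiv ?_
        ext v
        simp only [sum_apply, ContinuousLinearMap.comp_apply,
          ContinuousLinearMap.prod_apply, ← map_sum]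
        congr 1
        ext
        · simp [Prod.fst_sum, Finset.sum_range_succ, hD0 k le_rfl]
        · simp only [Prod.snd_sum]
          rw [Finset.sum_eq_single k]
          · simp
          · intro j _ hj
            simp [hj.symm]
          · simp
  obtain ⟨D, hD, -, hX⟩ := key n le_rfl
  have hF' := hF.hasFDerivAt
  have e1 : ∀ j, fderiv ℝ (fun g' => F (Y j g' n)) g = (fderiv ℝ F (X g n)).comp (D j) := by
    intro j
    refine (HasFDerivAt.comp (g := F) g ?_ (hD j)).fderiv
    rw [hYX]
    exact hF'
  have e2 : fderiv ℝ (fun g' => F (X g' n)) g =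
      (fderiv ℝ F (X g n)).comp (∑ j ∈ Finset.range n, D j) :=
    (HasFDerivAt.comp (g := F) g hF' hX).fderiv
  simp only [gradient, e1, e2, ← map_sum]
  congr 1
  ext v
  simp
end
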